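/- arXiv:2101.10415 — 2 statements merged into one kernel-verified Lean document; each statement's English description precedes it below -/
import Mathlib

section
/- Let k be a positive integer greater than 4 of the form p(p−1)/2 + 1 for some positive integer p (so k ∈ {7, 11, 16, 22, …}). Then there are infinitely many odd perfect squares having exactly k non-zero digits in their binary representation. -/
/-- The number of non-zero binary digits of `n`. -/
def binaryWeight (n : ℕ) : ℕ := ((Nat.digits 2 n).filter (· ≠ 0)).length

theorem binaryWeight_zero : binaryWeight 0 = 0 := by simp [binaryWeight]

theorem binaryWeight_two_mul (n : ℕ) : binaryWeight (2 * n) = binaryWeight n := by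
  rcases Nat.eq_zero_or_pos n with rfl | hn
  · rfl
  · have h := Nat.digits_add 2 one_lt_two 0 n two_pos (Or.inr hn.ne')
    rw [zero_add] at h
    simp [binaryWeight, h]

theorem binaryWeight_two_mul_add_one (n : ℕ) :
    binaryWeight (2 * n + 1) = binaryWeight n + 1 := by
  have h := Nat.digits_add 2 one_lt_two 1 n one_lt_two (Or.inl one_ne_zero)
  rw [add_comm 1] at h
  rw [binaryWeight, h]
  simp [binaryWeight]

theorem binaryWeight_two_pow_mul_add (a x y : ℕ) (hy : y < 2 ^ a) :
    binaryWeight (2 ^ a * x + y) = binaryWeight x + binaryWeight y := by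
  induction a generalizing y with
  | zero =>
    obtain rfl : y = 0 := by simpa using hy
    simp [binaryWeight_zero]
  | succ a ih =>
    rw [pow_succ] at hy ⊢
    obtain ⟨z, rfl | rfl⟩ := Nat.even_or_odd' y
    · rw [show 2 ^ a * 2 * x + 2 * z = 2 * (2 ^ a * x + z) by ring, binaryWeight_two_mul,
        binaryWeight_two_mul, ih z (by omega)]
    · rw [show 2 ^ a * 2 * x + (2 * z + 1) = 2 * (2 ^ a * x + z) + 1 by ring,
        binaryWeight_two_mul_add_one, binaryWeight_two_mul_add_one, ih z (by omega), add_assoc]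

theorem binaryWeight_one : binaryWeight 1 = 1 := by simp [binaryWeight]

theorem exists_binaryWeight_eq (i : ℕ) : ∃ r, r + 1 = 2 ^ i ∧ binaryWeight r = i := by
  induction i with
  | zero => exact ⟨0, rfl, binaryWeight_zero⟩
  | succ i ih =>
    obtain ⟨r, hr, hw⟩ := ih
    exact ⟨2 * r + 1, by rw [pow_succ, ← hr]; ring, by rw [binaryWeight_two_mul_add_one, hw]⟩

theorem exists_odd_binaryWeight_add_sq_even (i : ℕ) :
    ∃ c, Odd c ∧ binaryWeight c + binaryWeight (c ^ 2) = 2 * (i + 1) := by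
  obtain ⟨r, hr, hw⟩ := exists_binaryWeight_eq i
  refine ⟨2 * r + 1, odd_two_mul_add_one r, ?_⟩
  have hsq : (2 * r + 1) ^ 2 = 2 ^ (i + 2) * r + 1 := by rw [pow_add, ← hr]; ring
  rw [hsq, binaryWeight_two_pow_mul_add _ _ _ (Nat.one_lt_two_pow (by omega)),
    binaryWeight_two_mul_add_one, hw, binaryWeight_one]
  ring

theorem exists_odd_binaryWeight_add_sq_odd (i : ℕ) :
    ∃ c, Odd c ∧ binaryWeight c + binaryWeight (c ^ 2) = 2 * i + 5 := by
  obtain ⟨q, hq, hw⟩ := exists_binaryWeight_eq i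
  refine ⟨2 * (2 * (2 * q + 1)) + 1, odd_two_mul_add_one _, ?_⟩
  have hsq : (2 * (2 * (2 * q + 1)) + 1) ^ 2
      = 2 ^ (i + 4) * (2 * (2 * q) + 1) + (2 * (2 * (2 * 1)) + 1) := by
    rw [pow_add, ← hq]; ring
  have hlt : 2 * (2 * (2 * 1)) + 1 < 2 ^ (i + 4) := by
    rw [pow_add]; have := Nat.one_le_two_pow (n := i); omega
  rw [hsq, binaryWeight_two_pow_mul_add _ _ _ hlt]
  simp only [binaryWeight_two_mul_add_one, binaryWeight_two_mul, binaryWeight_one, hw]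
  ring

theorem binaryWeight_sq_two_pow_add (a c : ℕ) (h : c ^ 2 < 2 ^ a) :
    binaryWeight ((2 ^ (a + 1) + c) ^ 2) = 1 + binaryWeight c + binaryWeight (c ^ 2) := by
  have hc : c < 2 ^ a := (Nat.le_self_pow two_ne_zero c).trans_lt h
  have hsq : (2 ^ (a + 1) + c) ^ 2 = 2 ^ (a + 2) * (2 ^ a * 1 + c) + c ^ 2 := by ring
  rw [hsq, binaryWeight_two_pow_mul_add _ _ _ (h.trans (Nat.pow_lt_pow_right one_lt_two (by omega))),
    binaryWeight_two_pow_mul_add _ _ _ hc, binaryWeight_one]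

theorem infinite_odd_sq_binaryWeight_eq (c : ℕ) (hc : Odd c) :
    {n : ℕ | Odd n ∧ (∃ m : ℕ, n = m ^ 2) ∧
      binaryWeight n = 1 + binaryWeight c + binaryWeight (c ^ 2)}.Infinite := by
  refine Set.infinite_of_forall_exists_gt fun N => ?_
  set a := N + c ^ 2
  have ha : a < 2 ^ a := Nat.lt_two_pow_self
  refine ⟨(2 ^ (a + 1) + c) ^ 2, ⟨?_, ⟨_, rfl⟩, binaryWeight_sq_two_pow_add a c (by omega)⟩, ?_⟩
  · exact ((even_two.pow_of_ne_zero (Nat.succ_ne_zero a)).add_odd hc).pow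
  · have h1 := Nat.le_self_pow two_ne_zero (2 ^ (a + 1) + c)
    have h2 : 2 ^ (a + 1) = 2 * 2 ^ a := by ring
    omega

theorem infinitely_many_odd_squares_binary_triangular_form
    (k : ℕ) (hk : 4 < k)
    (hform : ∃ p : ℕ, 0 < p ∧ k = p * (p - 1) / 2 + 1) :
    {n : ℕ | Odd n ∧ (∃ m : ℕ, n = m ^ 2) ∧
      ((Nat.digits 2 n).filter (· ≠ 0)).length = k}.Infinite := by
  obtain ⟨c, hc, hw⟩ : ∃ c, Odd c ∧ 1 + binaryWeight c + binaryWeight (c ^ 2) = k := by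
    obtain ⟨j, rfl | rfl⟩ := Nat.even_or_odd' k
    · obtain ⟨c, hc, hw⟩ := exists_odd_binaryWeight_add_sq_odd (j - 3)
      exact ⟨c, hc, by omega⟩
    · obtain ⟨c, hc, hw⟩ := exists_odd_binaryWeight_add_sq_even (j - 1)
      exact ⟨c, hc, by omega⟩
  rw [← hw]
  exact infinite_odd_sq_binaryWeight_eq c hc
end

section
/- Let x ≥ 3 be an integer, let p ≥ 2 be an integer, let β be an integer with 0 ≤ β ≤ p − 2, and let α₀ = 0 < α₁ < … < α_{p−1} be integers such that α₁ ≥ 3, α_i = 2α_{i−1} for all i with 2 ≤ i ≤ β + 1, and α_i > 2α_{i−1} for all i with β + 2 ≤ i ≤ p − 1. Then the square y² of y = x^{α₀} + x^{α₁} + … + x^{α_{p−1}} has exactly p(p+1)/2 − β non-zero digits in its base-x representation. -/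
/-- The number of non-zero digits of `n` in base `x`. -/
def nonzeroDigitCount (x n : ℕ) : ℕ := ((Nat.digits x n).filter (· ≠ 0)).length

lemma nonzeroDigitCount_zero (x : ℕ) : nonzeroDigitCount x 0 = 0 := by
  simp [nonzeroDigitCount]

lemma nonzeroDigitCount_add_mul {x r : ℕ} (hx : 1 < x) (hr : r < x) (q : ℕ) :
    nonzeroDigitCount x (r + x * q) = (if r = 0 then 0 else 1) + nonzeroDigitCount x q := by
  by_cases h : r = 0 ∧ q = 0
  · obtain ⟨rfl, rfl⟩ := h
    simp [nonzeroDigitCount_zero]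
  · have h' : r ≠ 0 ∨ q ≠ 0 := by tauto
    unfold nonzeroDigitCount
    rw [Nat.digits_add x hx r q hr h', List.filter_cons]
    by_cases h0 : r = 0 <;> simp [h0, add_comm]

lemma nonzeroDigitCount_of_lt {x r : ℕ} (hx : 1 < x) (hr : r < x) (h0 : r ≠ 0) :
    nonzeroDigitCount x r = 1 := by
  simpa [h0, nonzeroDigitCount_zero] using nonzeroDigitCount_add_mul hx hr 0

lemma nonzeroDigitCount_add_pow_mul {x : ℕ} (hx : 1 < x) (b m : ℕ) :
    ∀ a, a < x ^ m →
      nonzeroDigitCount x (a + x ^ m * b) = nonzeroDigitCount x a + nonzeroDigitCount x b := by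
  induction m with
  | zero =>
    intro a ha
    obtain rfl : a = 0 := by simpa using ha
    simp [nonzeroDigitCount_zero]
  | succ m ih =>
    intro a ha
    have hr : a % x < x := Nat.mod_lt _ (by omega)
    have hq : a / x < x ^ m := Nat.div_lt_of_lt_mul (by rwa [pow_succ'] at ha)
    have e : a + x ^ (m + 1) * b = a % x + x * (a / x + x ^ m * b) := by
      conv_lhs => rw [← Nat.mod_add_div a x]
      ring
    rw [e, nonzeroDigitCount_add_mul hx hr, ih _ hq]
    conv_rhs => rw [← Nat.mod_add_div a x, nonzeroDigitCount_add_mul hx hr]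
    ring

lemma nonzeroDigitCount_three {x : ℕ} (hx : 3 ≤ x) : nonzeroDigitCount x 3 = 1 := by
  rcases hx.eq_or_lt with rfl | h
  · simp [nonzeroDigitCount]
  · exact nonzeroDigitCount_of_lt (by omega) h (by norm_num)

section SumOfPowers

variable {x p : ℕ} {α : ℕ → ℕ}

lemma mul_pow_le_pow_of_add_three_le (hx : 3 ≤ x) {a b : ℕ} (h : a + 3 ≤ b) :
    27 * x ^ a ≤ x ^ b :=
  calc 27 * x ^ a = 3 ^ 3 * x ^ a := by norm_num
    _ ≤ x ^ 3 * x ^ a := by gcongr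
    _ = x ^ (a + 3) := by ring
    _ ≤ x ^ b := Nat.pow_le_pow_right (by omega) h

lemma sum_pow_le (hx : 3 ≤ x) (hgap : ∀ i, i + 1 < p → α i + 3 ≤ α (i + 1)) :
    ∀ k, k < p → 26 * ∑ i ∈ Finset.range (k + 1), x ^ α i ≤ 27 * x ^ α k := by
  intro k
  induction k with
  | zero => intro _; simp; omega
  | succ k ih =>
    intro hk
    rw [Finset.sum_range_succ]
    have := ih (by omega)
    have := mul_pow_le_pow_of_add_three_le hx (hgap k hk)
    omega

lemma nonzeroDigitCount_two_mul_sum_pow_add (hx : 3 ≤ x) (hα0 : α 0 = 0)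
    (hgap : ∀ i, i + 1 < p → α i + 3 ≤ α (i + 1)) {e : ℕ} (he : e ≤ 1) :
    ∀ k, k < p →
      nonzeroDigitCount x (e + 2 * ∑ i ∈ Finset.range (k + 1), x ^ α i) = k + 1 := by
  intro k
  induction k with
  | zero =>
    intro _
    interval_cases e
    · simpa [hα0] using nonzeroDigitCount_of_lt (x := x) (r := 2) (by omega) (by omega) (by simp)
    · simpa [hα0] using nonzeroDigitCount_three hx
  | succ k ih =>
    intro hk
    have h1 := sum_pow_le hx hgap k (by omega)
    have h2 := mul_pow_le_pow_of_add_three_le hx (hgap k hk)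
    have h3 : 0 < x ^ α k := by positivity
    rw [Finset.sum_range_succ, mul_add, ← add_assoc, mul_comm 2 (x ^ _),
      nonzeroDigitCount_add_pow_mul (by omega) _ _ _ (by omega), ih (by omega),
      nonzeroDigitCount_of_lt (by omega) (by omega) (by norm_num)]

lemma nonzeroDigitCount_two_mul_sum_pow_add_pow (hx : 3 ≤ x) (hα0 : α 0 = 0)
    (hgap : ∀ i, i + 1 < p → α i + 3 ≤ α (i + 1)) {e : ℕ} (he : e ≤ 1) {k : ℕ}
    (hk : k + 1 < p) :
    nonzeroDigitCount x (e + 2 * ∑ i ∈ Finset.range (k + 1), x ^ α i + x ^ α (k + 1)) = k + 2 := by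
  have h1 := sum_pow_le hx hgap k (by omega)
  have h2 := mul_pow_le_pow_of_add_three_le hx (hgap k hk)
  have h3 : 0 < x ^ α k := by positivity
  rw [← mul_one (x ^ α (k + 1)), nonzeroDigitCount_add_pow_mul (by omega) _ _ _ (by omega),
    nonzeroDigitCount_two_mul_sum_pow_add hx hα0 hgap he k (by omega),
    nonzeroDigitCount_of_lt (by omega) (by omega) (by norm_num)]

lemma nonzeroDigitCount_sq_sum_pow_succ_of_two_mul_lt (hx : 3 ≤ x) (hα0 : α 0 = 0)
    (hgap : ∀ i, i + 1 < p → α i + 3 ≤ α (i + 1)) {k : ℕ} (hk : k + 1 < p)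
    (h : 2 * α k < α (k + 1)) :
    nonzeroDigitCount x ((∑ i ∈ Finset.range (k + 2), x ^ α i) ^ 2) =
      nonzeroDigitCount x ((∑ i ∈ Finset.range (k + 1), x ^ α i) ^ 2) + (k + 2) := by
  have h1 := sum_pow_le hx hgap k (by omega)
  have h2 := nonzeroDigitCount_two_mul_sum_pow_add_pow hx hα0 hgap (Nat.zero_le 1) hk
  have h3 : 3 * (x ^ α k) ^ 2 ≤ x ^ α (k + 1) :=
    calc 3 * (x ^ α k) ^ 2 ≤ x * (x ^ α k) ^ 2 := by gcongr
      _ = x ^ (2 * α k + 1) := by ring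
      _ ≤ _ := Nat.pow_le_pow_right (by omega) h
  have h4 : 0 < x ^ α k := by positivity
  rw [Finset.sum_range_succ _ (k + 1)]
  set S := ∑ i ∈ Finset.range (k + 1), x ^ α i
  have hS : S ^ 2 < x ^ α (k + 1) := by nlinarith
  rw [show (S + x ^ α (k + 1)) ^ 2 = S ^ 2 + x ^ α (k + 1) * (0 + 2 * S + x ^ α (k + 1)) by ring,
    nonzeroDigitCount_add_pow_mul (by omega) _ _ _ hS, h2]

lemma nonzeroDigitCount_sq_sum_pow_succ_of_eq_two_mul (hx : 3 ≤ x) (hα0 : α 0 = 0)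
    (hgap : ∀ i, i + 1 < p → α i + 3 ≤ α (i + 1)) {k : ℕ} (hk : k + 1 < p)
    (h : α (k + 1) = 2 * α k) :
    nonzeroDigitCount x ((∑ i ∈ Finset.range (k + 2), x ^ α i) ^ 2) =
      nonzeroDigitCount x ((∑ i ∈ Finset.range (k + 1), x ^ α i) ^ 2) + (k + 1) := by
  have h1 := sum_pow_le hx hgap k (by omega)
  have h2 := nonzeroDigitCount_two_mul_sum_pow_add_pow hx hα0 hgap le_rfl hk
  have h3 : x ^ α (k + 1) = (x ^ α k) ^ 2 := by rw [h]; ring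
  have h4 : 0 < x ^ α k := by positivity
  have h5 : x ^ α k ≤ ∑ i ∈ Finset.range (k + 1), x ^ α i := by
    rw [Finset.sum_range_succ]; omega
  rw [Finset.sum_range_succ _ (k + 1)]
  set S := ∑ i ∈ Finset.range (k + 1), x ^ α i
  obtain ⟨R, hR⟩ : ∃ R, S ^ 2 = R + x ^ α (k + 1) * 1 := by
    obtain ⟨R, hR⟩ := Nat.exists_eq_add_of_le (Nat.pow_le_pow_left h5 2)
    exact ⟨R, by rw [hR, h3]; ring⟩
  have hlt : R < x ^ α (k + 1) := by nlinarith
  rw [show (S + x ^ α (k + 1)) ^ 2 = S ^ 2 + x ^ α (k + 1) * (2 * S + x ^ α (k + 1)) by ring, hR,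
    show R + x ^ α (k + 1) * 1 + x ^ α (k + 1) * (2 * S + x ^ α (k + 1)) =
      R + x ^ α (k + 1) * (1 + 2 * S + x ^ α (k + 1)) by ring,
    nonzeroDigitCount_add_pow_mul (by omega) _ _ _ hlt,
    nonzeroDigitCount_add_pow_mul (by omega) _ _ _ hlt, h2,
    nonzeroDigitCount_of_lt (by omega) (by omega) one_ne_zero]
  ring

end SumOfPowers

theorem base_x_digit_count_of_square_of_sum_of_powers
    (x : ℕ) (hx : 3 ≤ x)
    (p β : ℕ) (hp : 2 ≤ p) (hβ : β ≤ p - 2)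
    (α : ℕ → ℕ) (hα0 : α 0 = 0) (hα1 : 3 ≤ α 1)
    (hmono : ∀ i, i + 1 < p → α i < α (i + 1))
    (heq : ∀ i, 2 ≤ i → i ≤ β + 1 → α i = 2 * α (i - 1))
    (hgt : ∀ i, β + 2 ≤ i → i ≤ p - 1 → α i > 2 * α (i - 1)) :
    ((Nat.digits x ((∑ i ∈ Finset.range p, x ^ α i) ^ 2)).filter (· ≠ 0)).length
      = p * (p + 1) / 2 - β := by
  have hge : ∀ i, i + 1 < p → 3 ≤ α (i + 1) := by
    intro i
    induction i with
    | zero => intro _; exact hα1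
    | succ i ih => intro hi; have := ih (by omega); have := hmono (i + 1) hi; omega
  have hgap : ∀ i, i + 1 < p → α i + 3 ≤ α (i + 1) := by
    intro i hi
    rcases i with _ | i
    · simpa [hα0] using hα1
    · have h3 := hge i (by omega)
      by_cases h : i + 2 ≤ β + 1
      · have : α (i + 1 + 1) = 2 * α (i + 1) := heq (i + 2) (by omega) h
        omega
      · have : α (i + 1 + 1) > 2 * α (i + 1) := hgt (i + 2) (by omega) (by omega)
        omega
  have key : ∀ k, k < p →
      2 * (nonzeroDigitCount x ((∑ i ∈ Finset.range (k + 1), x ^ α i) ^ 2) + min (k - 1) β) =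
        (k + 1) * (k + 2) := by
    intro k
    induction k with
    | zero =>
      intro _
      simp [hα0, nonzeroDigitCount_of_lt (x := x) (r := 1) (by omega) (by omega)]
    | succ k ih =>
      intro hk
      have ih := ih (by omega)
      by_cases h : 1 ≤ k ∧ k ≤ β
      · rw [nonzeroDigitCount_sq_sum_pow_succ_of_eq_two_mul hx hα0 hgap hk
          (heq (k + 1) (by omega) (by omega))]
        have : min (k + 1 - 1) β = min (k - 1) β + 1 := by omega
        rw [this]
        linarith
      · have h2 : 2 * α k < α (k + 1) := by
          rcases Nat.eq_zero_or_pos k with rfl | h0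
          · simp only [hα0, zero_add]; omega
          · exact hgt (k + 1) (by omega) (by omega)
        rw [nonzeroDigitCount_sq_sum_pow_succ_of_two_mul_lt hx hα0 hgap hk h2]
        have : min (k + 1 - 1) β = min (k - 1) β := by omega
        rw [this]
        linarith
  have hfin := key (p - 1) (by omega)
  rw [show p - 1 + 1 = p by omega, show p - 1 + 2 = p + 1 by omega,
    show min (p - 1 - 1) β = β by omega] at hfin
  change nonzeroDigitCount x _ = _
  omega
end
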